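/- For a real number T > 0, define (with T^z := exp(z·log T) for z ∈ ℂ) A(T,s) = ξ(2)·ξ(3s)·T^{3s+1}/(3s−3) − ξ(2)·ξ(3s−2)·T/(3s) − (1/2)·ξ(3s)·T^{3s}/(3s−2) + (1/2)·ξ(3s−2)·T^{−3s+3}/(3s−1) − ξ(3s−1)·T^{−3s+4}/((3s−3)(3s)) and B(T,s) = −ξ(2)·ξ(3s−2)·T^{−3s+4}/(3s) + ξ(2)·ξ(3s)·T/(3s−3) − (1/2)·ξ(3s)·T^{3s}/(3s−2) + (1/2)·ξ(3s−2)·T^{−3s+3}/(3s−1) − ξ(3s−1)·T^{3s+1}/((3s−3)(3s)). Then for every real T > 0 and every complex s with s ∉ {0, 1/3, 2/3, 1}, one has A(T, 1−s) = B(T, s). -/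

import Mathlib

open Complex

local notation "ξ" => completedRiemannZeta

/-- The power `T^z := exp(z · log T)` of a positive real `T` by a complex exponent. -/
noncomputable def cpowT (T : ℝ) (z : ℂ) : ℂ := Complex.exp (z * Real.log T)

/-- Weng's `T`-version zeta `ξ_{ℚ;T}^{SL(3)/P_{1,2}}(s)`. -/
noncomputable def wengSL3P12T (T : ℝ) (s : ℂ) : ℂ :=
  ξ 2 * ξ (3*s) * cpowT T (3*s + 1) / (3*s - 3)
    - ξ 2 * ξ (3*s - 2) * (T : ℂ) / (3*s)
    - (1/2) * ξ (3*s) * cpowT T (3*s) / (3*s - 2)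
    + (1/2) * ξ (3*s - 2) * cpowT T (-(3*s) + 3) / (3*s - 1)
    - ξ (3*s - 1) * cpowT T (-(3*s) + 4) / ((3*s - 3) * (3*s))

/-- Weng's `T`-version zeta `ξ_{ℚ;T}^{SL(3)/P_{2,1}}(s)`. -/
noncomputable def wengSL3P21T (T : ℝ) (s : ℂ) : ℂ :=
  -(ξ 2 * ξ (3*s - 2) * cpowT T (-(3*s) + 4) / (3*s))
    + ξ 2 * ξ (3*s) * (T : ℂ) / (3*s - 3)
    - (1/2) * ξ (3*s) * cpowT T (3*s) / (3*s - 2)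
    + (1/2) * ξ (3*s - 2) * cpowT T (-(3*s) + 3) / (3*s - 1)
    - ξ (3*s - 1) * cpowT T (3*s + 1) / ((3*s - 3) * (3*s))

/-- The `T`-version functional equation for `SL(3)`, exchanging the maximal
parabolics `P_{1,2}` and `P_{2,1}`. -/
theorem wengSL3T_functional_equation (T : ℝ) (hT : 0 < T) (s : ℂ)
    (hs : s ∉ ({0, 1/3, 2/3, 1} : Set ℂ)) :
    wengSL3P12T T (1 - s) = wengSL3P21T T s := by
  have h₁ : ξ (3 * (1 - s)) = ξ (3 * s - 2) := by
    rw [← completedRiemannZeta_one_sub]; ring_nf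
  have h₂ : ξ (3 * (1 - s) - 2) = ξ (3 * s) := by
    rw [← completedRiemannZeta_one_sub]; ring_nf
  have h₃ : ξ (3 * (1 - s) - 1) = ξ (3 * s - 1) := by
    rw [← completedRiemannZeta_one_sub]; ring_nf
  have e₁ : 3 * (1 - s) + 1 = -(3 * s) + 4 := by ring
  have e₂ : 3 * (1 - s) = -(3 * s) + 3 := by ring
  have e₃ : -(3 * (1 - s)) + 3 = 3 * s := by ring
  have e₄ : -(3 * (1 - s)) + 4 = 3 * s + 1 := by ring
  have d₁ : 3 * (1 - s) - 3 = -(3 * s) := by ring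
  have d₂ : 3 * (1 - s) - 2 = -(3 * s - 1) := by ring
  have d₃ : 3 * (1 - s) - 1 = -(3 * s - 2) := by ring
  have d₄ : -(3 * s) + 3 = -(3 * s - 3) := by ring
  unfold wengSL3P12T wengSL3P21T
  rw [h₁, h₂, h₃, e₁, e₃, e₄, d₁, d₂, d₃, e₂]
  generalize cpowT T (-(3 * s) + 3) = p
  rw [d₄, neg_mul_neg, mul_comm (3 * s) (3 * s - 3)]
  simp only [div_neg]
  ring
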